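/- Let q be an odd prime power and F = GF(q). Let y ∈ F^6 be nonzero with rank(M_y) = 2 and y exterior. Then among the conics of the squab S_y there are exactly 2q+1 double lines, exactly (q^3+3q^2)/2 pairs of real lines, exactly (q^3+q^2)/2 − q pairs of imaginary lines, and exactly q^4−q^2 nonsingular conics. -/

import Mathlib

open Matrix

namespace Conics

/-- Coefficient vector (a0,...,a5) of the product of two linear forms
`(b0*X0+b1*X1+b2*X2)*(c0*X0+c1*X1+c2*X2)`, where the quadratic form with
coefficient vector `a` is `a0*X0^2 + a1*X0*X1 + a2*X0*X2 + a3*X1^2 + a4*X1*X2 + a5*X2^2`. -/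
def mulLin {F : Type} [Field F] (b c : Fin 3 → F) : Fin 6 → F :=
  ![b 0 * c 0, b 0 * c 1 + b 1 * c 0, b 0 * c 2 + b 2 * c 0,
    b 1 * c 1, b 1 * c 2 + b 2 * c 1, b 2 * c 2]

/-- The discriminant of the quadratic form with coefficient vector `a`. -/
def disc {F : Type} [Field F] (a : Fin 6 → F) : F :=
  4 * a 0 * a 3 * a 5 + a 1 * a 2 * a 4 - a 0 * a 4 ^ 2 - a 3 * a 2 ^ 2 - a 5 * a 1 ^ 2

/-- `f_a` is a double line: `f_a = c * l^2` for a nonzero scalar `c` and nonzero linear form `l`. -/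
def IsDoubleLine {F : Type} [Field F] (a : Fin 6 → F) : Prop :=
  ∃ (c : F) (l : Fin 3 → F), c ≠ 0 ∧ l ≠ 0 ∧ a = c • mulLin l l

/-- `f_a` is a pair of (distinct) real lines: `f_a = l1 * l2` with neither linear form a scalar
multiple of the other. -/
def IsRealPair {F : Type} [Field F] (a : Fin 6 → F) : Prop :=
  ∃ l1 l2 : Fin 3 → F, (¬ ∃ t : F, l2 = t • l1) ∧ (¬ ∃ t : F, l1 = t • l2) ∧ a = mulLin l1 l2

/-- `f_a` is a pair of conjugate imaginary lines: singular, but not a product of two linear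
forms over `F`. -/
def IsImagPair {F : Type} [Field F] (a : Fin 6 → F) : Prop :=
  disc a = 0 ∧ ¬ ∃ l1 l2 : Fin 3 → F, a = mulLin l1 l2

/-- `f_a` is a nonsingular conic. -/
def IsNonsingular {F : Type} [Field F] (a : Fin 6 → F) : Prop :=
  disc a ≠ 0

/-- The number of conics of a given type `T` in a linear system `W` (a subspace of the space of
quadratic forms, identified with `F^6`): the number of 1-dimensional subspaces `⟨a⟩` of `W`,
`a ≠ 0`, such that `f_a` has type `T`. -/
noncomputable def numConics {F : Type} [Field F] (W : Submodule F (Fin 6 → F))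
    (T : (Fin 6 → F) → Prop) : ℕ :=
  Set.ncard {P : Submodule F (Fin 6 → F) |
    ∃ a : Fin 6 → F, a ≠ 0 ∧ a ∈ W ∧ T a ∧ P = Submodule.span F {a}}

/-- The symmetric 3×3 matrix associated with a point `y` of `PG(5,q)`. -/
def M {F : Type} [Field F] (y : Fin 6 → F) : Matrix (Fin 3) (Fin 3) F :=
  !![y 0, y 1, y 2; y 1, y 3, y 4; y 2, y 4, y 5]

/-- The pairing `B(a,y) = a0*y0 + ... + a5*y5`. -/
def Bform {F : Type} [Field F] (a y : Fin 6 → F) : F :=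
  a 0 * y 0 + a 1 * y 1 + a 2 * y 2 + a 3 * y 3 + a 4 * y 4 + a 5 * y 5

/-- The squab of conics associated with a (nonzero) point `y`: the hyperplane
`{a : B(a,y) = 0}` of the space of quadratic forms. -/
def squab {F : Type} [Field F] (y : Fin 6 → F) : Submodule F (Fin 6 → F) where
  carrier := {a | Bform a y = 0}
  add_mem' := by
    intro a b ha hb
    simp only [Set.mem_setOf_eq, Bform, Pi.add_apply] at *
    linear_combination ha + hb
  zero_mem' := by simp [Bform]
  smul_mem' := by
    intro c a ha
    simp only [Set.mem_setOf_eq, Bform, Pi.smul_apply, smul_eq_mul] at *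
    linear_combination c * ha

/-- For `q` odd, a rank-2 point `y` is exterior if some vector `v` satisfies
`vᵀ M_y v = 0` and `M_y v ≠ 0`; a rank-2 point is interior otherwise. -/
def IsExterior {F : Type} [Field F] (y : Fin 6 → F) : Prop :=
  ∃ v : Fin 3 → F, v ⬝ᵥ (M y).mulVec v = 0 ∧ (M y).mulVec v ≠ 0

section Helpers

variable {F : Type} [Field F]

/-- Substitution action of a matrix on quadratic forms. -/
def act (G : Matrix (Fin 3) (Fin 3) F) (a : Fin 6 → F) : Fin 6 → F :=
  a 0 • mulLin (fun i => G i 0) (fun i => G i 0) + a 1 • mulLin (fun i => G i 0) (fun i => G i 1)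
  + a 2 • mulLin (fun i => G i 0) (fun i => G i 2) + a 3 • mulLin (fun i => G i 1) (fun i => G i 1)
  + a 4 • mulLin (fun i => G i 1) (fun i => G i 2) + a 5 • mulLin (fun i => G i 2) (fun i => G i 2)

lemma act_mulLin (G : Matrix (Fin 3) (Fin 3) F) (b c : Fin 3 → F) :
    act G (mulLin b c) = mulLin (G.mulVec b) (G.mulVec c) := by
  funext i
  fin_cases i <;> simp [act, mulLin, Matrix.mulVec, dotProduct, Fin.sum_univ_three] <;> ring

lemma act_smul (G : Matrix (Fin 3) (Fin 3) F) (t : F) (a : Fin 6 → F) :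
    act G (t • a) = t • act G a := by
  funext i
  simp [act]; ring

lemma act_add (G : Matrix (Fin 3) (Fin 3) F) (a b : Fin 6 → F) :
    act G (a + b) = act G a + act G b := by
  funext i
  simp [act]; ring

lemma act_one (a : Fin 6 → F) : act 1 a = a := by
  funext i
  fin_cases i <;> simp [act, mulLin]

lemma act_mul (G H : Matrix (Fin 3) (Fin 3) F) (a : Fin 6 → F) :
    act G (act H a) = act (G * H) a := by
  have h : ∀ j, G.mulVec (fun i => H i j) = fun i => (G * H) i j := by
    intro j; funext i; simp [Matrix.mulVec, dotProduct, Matrix.mul_apply]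
  conv_lhs => rw [act.eq_def H a]
  simp only [act_add, act_smul, act_mulLin, h]
  rfl

lemma act_inv {G H : Matrix (Fin 3) (Fin 3) F} (h : H * G = 1) (a : Fin 6 → F) :
    act H (act G a) = a := by rw [act_mul, h, act_one]

/-- doubled Gram matrix -/
def S (a : Fin 6 → F) : Matrix (Fin 3) (Fin 3) F :=
  !![2 * a 0, a 1, a 2; a 1, 2 * a 3, a 4; a 2, a 4, 2 * a 5]

lemma det_S (a : Fin 6 → F) : (S a).det = 2 * disc a := by
  simp [S, Matrix.det_fin_three, disc]; ring

lemma S_act (G : Matrix (Fin 3) (Fin 3) F) (a : Fin 6 → F) :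
    S (act G a) = G * S a * Gᵀ := by
  ext i j
  fin_cases i <;> fin_cases j <;>
    simp [S, act, mulLin, Matrix.mul_apply, Fin.sum_univ_three] <;> ring

lemma disc_act (h2 : (2 : F) ≠ 0) (G : Matrix (Fin 3) (Fin 3) F) (a : Fin 6 → F) :
    disc (act G a) = G.det ^ 2 * disc a := by
  apply mul_left_cancel₀ h2
  rw [← det_S, S_act, Matrix.det_mul, Matrix.det_mul, det_S, Matrix.det_transpose]; ring

lemma mulVec_inv {G H : Matrix (Fin 3) (Fin 3) F} (h : H * G = 1) (b : Fin 3 → F) :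
    H.mulVec (G.mulVec b) = b := by simp [Matrix.mulVec_mulVec, h]

lemma act_double {G H : Matrix (Fin 3) (Fin 3) F} (h : H * G = 1) {a : Fin 6 → F}
    (ha : IsDoubleLine a) : IsDoubleLine (act G a) := by
  obtain ⟨c, l, hc, hl, rfl⟩ := ha
  refine ⟨c, G.mulVec l, hc, ?_, by rw [act_smul, act_mulLin]⟩
  intro h0
  apply hl
  rw [← mulVec_inv h l, h0, Matrix.mulVec_zero]

lemma act_real {G H : Matrix (Fin 3) (Fin 3) F} (h : H * G = 1) {a : Fin 6 → F}
    (ha : IsRealPair a) : IsRealPair (act G a) := by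
  obtain ⟨l, m, h1, h2, rfl⟩ := ha
  refine ⟨G.mulVec l, G.mulVec m, ?_, ?_, by rw [act_mulLin]⟩
  · rintro ⟨t, ht⟩
    exact h1 ⟨t, by rw [← mulVec_inv h m, ht, Matrix.mulVec_smul, mulVec_inv h]⟩
  · rintro ⟨t, ht⟩
    exact h2 ⟨t, by rw [← mulVec_inv h l, ht, Matrix.mulVec_smul, mulVec_inv h]⟩

lemma act_imag (h2 : (2 : F) ≠ 0) {G H : Matrix (Fin 3) (Fin 3) F} (h : H * G = 1) {a : Fin 6 → F}
    (ha : IsImagPair a) : IsImagPair (act G a) := by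
  refine ⟨by rw [disc_act h2, ha.1, mul_zero], ?_⟩
  rintro ⟨l, m, hlm⟩
  exact ha.2 ⟨H.mulVec l, H.mulVec m, by rw [← act_mulLin, ← hlm, act_inv h]⟩

lemma act_nonsing (h2 : (2 : F) ≠ 0) {G H : Matrix (Fin 3) (Fin 3) F} (h : H * G = 1)
    {a : Fin 6 → F} (ha : IsNonsingular a) : IsNonsingular (act G a) := by
  intro h0
  apply ha
  rw [← act_inv h a, disc_act h2, h0, mul_zero]

lemma smul_mulLin (t : F) (l m : Fin 3 → F) : t • mulLin l m = mulLin (t • l) m := by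
  funext i
  fin_cases i <;> simp [mulLin] <;> ring

lemma smul_double {t : F} (ht : t ≠ 0) {a : Fin 6 → F}
    (ha : IsDoubleLine a) : IsDoubleLine (t • a) := by
  obtain ⟨c, l, hc, hl, rfl⟩ := ha
  exact ⟨t * c, l, mul_ne_zero ht hc, hl, by rw [smul_smul]⟩

lemma smul_real {t : F} (ht : t ≠ 0) {a : Fin 6 → F}
    (ha : IsRealPair a) : IsRealPair (t • a) := by
  obtain ⟨l, m, h1, h2, rfl⟩ := ha
  refine ⟨t • l, m, ?_, ?_, smul_mulLin _ _ _⟩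
  · rintro ⟨s, hs⟩
    exact h1 ⟨s * t, by rw [hs, smul_smul]⟩
  · rintro ⟨s, hs⟩
    exact h2 ⟨t⁻¹ * s, by rw [mul_smul, ← hs, smul_smul, inv_mul_cancel₀ ht, one_smul]⟩

lemma disc_smul (t : F) (a : Fin 6 → F) : disc (t • a) = t ^ 3 * disc a := by
  simp [disc]; ring

lemma smul_imag {t : F} (ht : t ≠ 0) {a : Fin 6 → F}
    (ha : IsImagPair a) : IsImagPair (t • a) := by
  refine ⟨by rw [disc_smul, ha.1, mul_zero], ?_⟩
  rintro ⟨l, m, hlm⟩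
  exact ha.2 ⟨t⁻¹ • l, m, by rw [← smul_mulLin, ← hlm, smul_smul, inv_mul_cancel₀ ht, one_smul]⟩

lemma smul_nonsing {t : F} (ht : t ≠ 0) {a : Fin 6 → F}
    (ha : IsNonsingular a) : IsNonsingular (t • a) := by
  rw [IsNonsingular, disc_smul]
  exact mul_ne_zero (pow_ne_zero _ ht) ha

/-- Counting points through vectors. -/
lemma count_points [Fintype F] (W : Submodule F (Fin 6 → F)) (T : (Fin 6 → F) → Prop)
    (hT : ∀ t : F, t ≠ 0 → ∀ a, T a → T (t • a)) :
    (Fintype.card F - 1) * numConics W T = Set.ncard {a : Fin 6 → F | a ≠ 0 ∧ a ∈ W ∧ T a} := by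
  classical
  set A : Set (Fin 6 → F) := {a : Fin 6 → F | a ≠ 0 ∧ a ∈ W ∧ T a} with hA
  have e : {P : Submodule F (Fin 6 → F) |
    ∃ a : Fin 6 → F, a ≠ 0 ∧ a ∈ W ∧ T a ∧ P = Submodule.span F {a}} =
      (fun a => Submodule.span F {a}) '' A := by
    ext P
    simp only [Set.mem_ofPred_eq, Set.mem_image, hA]
    constructor
    · rintro ⟨a, h1, h2, h3, rfl⟩; exact ⟨a, ⟨h1, h2, h3⟩, rfl⟩
    · rintro ⟨a, ⟨h1, h2, h3⟩, rfl⟩; exact ⟨a, h1, h2, h3, rfl⟩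
  have e2 : ((fun a => Submodule.span F {a}) '' A).ncard =
      (A.toFinset.image (fun a => Submodule.span F {a})).card := by
    rw [← Set.ncard_coe_finset, Finset.coe_image, Set.coe_toFinset]
  rw [numConics, e, e2, Set.ncard_eq_toFinset_card' A]
  rw [Finset.card_eq_sum_card_image (fun a => Submodule.span F {a}) A.toFinset,
    Finset.sum_const_nat (m := Fintype.card F - 1), mul_comm]
  intro P hP
  obtain ⟨a, ha, rfl⟩ := Finset.mem_image.1 hP
  rw [Set.mem_toFinset] at ha
  have : A.toFinset.filter (fun b => Submodule.span F {b} = Submodule.span F {a}) =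
      (Finset.univ.erase (0 : F)).image (fun t => t • a) := by
    ext b
    simp only [Finset.mem_filter, Set.mem_toFinset, Finset.mem_image, Finset.mem_erase,
      Finset.mem_univ, and_true]
    constructor
    · rintro ⟨hb, hs⟩
      have : b ∈ Submodule.span F {a} := hs ▸ Submodule.mem_span_singleton_self b
      obtain ⟨t, rfl⟩ := Submodule.mem_span_singleton.1 this
      refine ⟨t, ?_, rfl⟩
      rintro rfl
      exact hb.1 (zero_smul _ _)
    · rintro ⟨t, ht, rfl⟩
      exact ⟨⟨smul_ne_zero ht ha.1, W.smul_mem _ ha.2.1, hT t ht _ ha.2.2⟩,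
        Submodule.span_singleton_smul_eq (IsUnit.mk0 t ht) a⟩
  rw [this, Finset.card_image_of_injective _ (smul_left_injective F ha.1),
    Finset.card_erase_of_mem (Finset.mem_univ _), Finset.card_univ]

lemma Bform_act (G : Matrix (Fin 3) (Fin 3) F) (a y : Fin 6 → F) (p : F)
    (g00 : (fun i => G i 0) ⬝ᵥ (M y).mulVec (fun i => G i 0) = 0)
    (g01 : (fun i => G i 1) ⬝ᵥ (M y).mulVec (fun i => G i 0) = p)
    (g11 : (fun i => G i 1) ⬝ᵥ (M y).mulVec (fun i => G i 1) = 0)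
    (g2 : (M y).mulVec (fun i => G i 2) = 0) :
    Bform (act G a) y = p * a 1 := by
  have g02 : (fun i => G i 0) ⬝ᵥ (M y).mulVec (fun i => G i 2) = 0 := by simp [g2]
  have g12 : (fun i => G i 1) ⬝ᵥ (M y).mulVec (fun i => G i 2) = 0 := by simp [g2]
  have g22 : (fun i => G i 2) ⬝ᵥ (M y).mulVec (fun i => G i 2) = 0 := by simp [g2]
  simp [M, dotProduct, Matrix.mulVec, Fin.sum_univ_three] at g00 g01 g11 g02 g12 g22
  simp [Bform, act, mulLin]
  linear_combination a 0 * g00 + a 1 * g01 + a 2 * g02 + a 3 * g11 + a 4 * g12 + a 5 * g22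

lemma exists_frame (h2 : (2 : F) ≠ 0) (y : Fin 6 → F) (hrk : (M y).rank = 2)
    (hext : IsExterior y) : ∃ (G H : Matrix (Fin 3) (Fin 3) F) (p : F), p ≠ 0 ∧ H * G = 1 ∧
      G * H = 1 ∧ ∀ a, Bform (act G a) y = p * a 1 := by
  obtain ⟨v, hv, hMv⟩ := hext
  have hsym : ∀ a b, a ⬝ᵥ (M y).mulVec b = b ⬝ᵥ (M y).mulVec a := by
    intro a b
    simp [M, dotProduct, Matrix.mulVec, Fin.sum_univ_three]; ring
  obtain ⟨w, hw⟩ : ∃ w, w ⬝ᵥ (M y).mulVec v ≠ 0 := by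
    obtain ⟨i, hi⟩ := Function.ne_iff.1 hMv
    exact ⟨Pi.single i 1, by simpa using hi⟩
  obtain ⟨k, hk, hMk⟩ : ∃ k, k ≠ 0 ∧ (M y).mulVec k = 0 := by
    rw [Matrix.exists_mulVec_eq_zero_iff]
    by_contra hd
    have := Matrix.rank_of_isUnit (M y) ((Matrix.isUnit_iff_isUnit_det _).2 (IsUnit.mk0 _ hd))
    simp [hrk] at this
  set p := w ⬝ᵥ (M y).mulVec v with hp
  obtain ⟨u, hu, huu⟩ : ∃ u, u ⬝ᵥ (M y).mulVec v = p ∧ u ⬝ᵥ (M y).mulVec u = 0 := by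
    refine ⟨w - ((w ⬝ᵥ (M y).mulVec w) / (2 * p)) • v, ?_, ?_⟩
    · simp [sub_dotProduct, hv, hp]
    · simp only [Matrix.mulVec_sub, Matrix.mulVec_smul, sub_dotProduct, dotProduct_sub,
        smul_dotProduct, dotProduct_smul, hv, hsym v w, ← hp, smul_eq_mul]
      field_simp
      ring
  let G : Matrix (Fin 3) (Fin 3) F := fun i j => ![v i, u i, k i] j
  have hG : G.det ≠ 0 := by
    intro hd
    obtain ⟨x, hx, hGx⟩ := Matrix.exists_mulVec_eq_zero_iff.2 hd
    have e : x 0 • v + x 1 • u + x 2 • k = 0 := by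
      rw [← hGx]; funext i
      simp [G, Matrix.mulVec, dotProduct, Fin.sum_univ_three]; ring
    have e1 : x 1 = 0 := by
      have := congrArg (fun z => z ⬝ᵥ (M y).mulVec v) e
      simp only [add_dotProduct, smul_dotProduct, hv, hu, hsym k v, hMk, dotProduct_zero,
        zero_dotProduct, smul_eq_mul, mul_zero, add_zero, zero_add] at this
      exact (mul_eq_zero.1 this).resolve_right hw
    have e0 : x 0 = 0 := by
      have := congrArg (fun z => z ⬝ᵥ (M y).mulVec u) e
      simp only [add_dotProduct, smul_dotProduct, huu, hsym v u, hu, hsym k u, hMk, dotProduct_zero,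
        zero_dotProduct, smul_eq_mul, mul_zero, add_zero] at this
      exact (mul_eq_zero.1 this).resolve_right hw
    have e2 : x 2 = 0 := by
      rw [e0, e1] at e
      simpa [hk] using e
    apply hx
    funext i; fin_cases i <;> simp [e0, e1, e2]
  refine ⟨G, G⁻¹, p, hw, Matrix.nonsing_inv_mul _ (IsUnit.mk0 _ hG),
    Matrix.mul_nonsing_inv _ (IsUnit.mk0 _ hG), fun a => Bform_act G a y p ?_ ?_ ?_ ?_⟩
  · simpa [G] using hv
  · simpa [G] using hu
  · simpa [G] using huu
  · simpa [G] using hMk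

lemma transport [Fintype F] (y : Fin 6 → F) (T : (Fin 6 → F) → Prop)
    {G H : Matrix (Fin 3) (Fin 3) F} {p : F} (hp : p ≠ 0) (hHG : H * G = 1) (hGH : G * H = 1)
    (hB : ∀ a, Bform (act G a) y = p * a 1)
    (hS : ∀ t : F, t ≠ 0 → ∀ a, T a → T (t • a))
    (hT : ∀ G H : Matrix (Fin 3) (Fin 3) F, H * G = 1 → ∀ a, T a → T (act G a)) :
    (Fintype.card F - 1) * numConics (squab y) T =
      Set.ncard {a : Fin 6 → F | a ≠ 0 ∧ a 1 = 0 ∧ T a} := by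
  rw [count_points _ _ hS]
  have hi : Function.Injective (act G) := fun a b h => by
    rw [← act_inv hHG a, h, act_inv hHG]
  rw [← Set.ncard_image_of_injective {a : Fin 6 → F | a ≠ 0 ∧ a 1 = 0 ∧ T a} hi]
  have h0 : ∀ K : Matrix (Fin 3) (Fin 3) F, act K 0 = 0 := fun K => by
    simpa using act_smul K 0 0
  congr 1
  ext a
  simp only [Set.mem_ofPred_eq, Set.mem_image]
  constructor
  · rintro ⟨h1, h2, h3⟩
    refine ⟨act H a, ⟨?_, ?_, hT _ _ hGH _ h3⟩, act_inv hGH a⟩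
    · intro h
      apply h1
      rw [← act_inv hGH a, h, h0]
    · have : Bform a y = 0 := h2
      rw [← act_inv hGH a, hB] at this
      exact (mul_eq_zero.1 this).resolve_left hp
  · rintro ⟨b, ⟨h1, h2, h3⟩, rfl⟩
    refine ⟨?_, ?_, hT _ _ hHG _ h3⟩
    · intro h
      apply h1
      rw [← act_inv hHG b, h, h0]
    · change Bform _ y = 0
      rw [hB, h2, mul_zero]

lemma ncard_param {α β : Type} (f : α → β) (g : β → α) (P : Set α) (A : Set β)
    (h1 : ∀ s ∈ P, f s ∈ A ∧ g (f s) = s) (h2 : ∀ a ∈ A, g a ∈ P ∧ f (g a) = a) :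
    A.ncard = P.ncard := by
  have : A = f '' P := by
    ext a
    constructor
    · intro ha
      exact ⟨g a, (h2 a ha).1, (h2 a ha).2⟩
    · rintro ⟨s, hs, rfl⟩
      exact (h1 s hs).1
  rw [this, Set.InjOn.ncard_image]
  intro s hs t ht hst
  rw [← (h1 s hs).2, ← (h1 t ht).2]
  exact congrArg g hst

/-- nonzero elements -/
def Uset (F : Type) [Field F] : Set F := {x | x ≠ 0}
/-- nonsquares -/
def Nset (F : Type) [Field F] : Set F := {x | ¬ IsSquare x}

lemma card_U [Fintype F] : (Uset F).ncard = Fintype.card F - 1 := by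
  classical
  have : Uset F = ((Finset.univ.erase (0 : F) : Finset F) : Set F) := by
    ext x; simp [Uset]
  rw [this, Set.ncard_coe_finset, Finset.card_erase_of_mem (Finset.mem_univ _), Finset.card_univ]

lemma card_univ' [Fintype F] : (Set.univ : Set F).ncard = Fintype.card F := by
  rw [Set.ncard_univ, Nat.card_eq_fintype_card]

lemma card_N [Fintype F] (h2 : ringChar F ≠ 2) : 2 * (Nset F).ncard = Fintype.card F - 1 := by
  classical
  have hN : (Nset F).ncard = (Finset.univ.filter (fun x : F => ¬ IsSquare x)).card := by
    rw [← Set.ncard_coe_finset]; congr 1; ext x; simp [Nset]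
  have z : ∑ x : F, (if x = 0 then (1 : ℤ) else 0) = 1 := by simp
  have hs := quadraticChar_sum_zero h2
  have : ∀ x : F, quadraticChar F x = 1 - (if x = 0 then 1 else 0)
      - 2 * (if ¬ IsSquare x then 1 else 0) := by
    intro x
    rw [quadraticChar_apply, quadraticCharFun]
    by_cases hx : x = 0
    · simp [hx]
    · by_cases hq : IsSquare x <;> simp [hx, hq]
  rw [Finset.sum_congr rfl (fun x _ => this x), Finset.sum_sub_distrib, Finset.sum_sub_distrib,
    ← Finset.mul_sum, z, Finset.sum_boole] at hs
  simp only [Finset.sum_const, Finset.card_univ, nsmul_eq_mul, mul_one] at hs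
  rw [hN]
  omega

lemma vec_ext {a b : Fin 6 → F} (h0 : a 0 = b 0) (h1 : a 1 = b 1) (h2 : a 2 = b 2)
    (h3 : a 3 = b 3) (h4 : a 4 = b 4) (h5 : a 5 = b 5) : a = b := by
  funext i; fin_cases i <;> assumption

section char
variable (F)

def D1 : Set (Fin 6 → F) := {a | a 1 = 0 ∧ a 0 ≠ 0 ∧ a 3 = 0 ∧ a 4 = 0 ∧ 4 * a 0 * a 5 = a 2 ^ 2}
def D2 : Set (Fin 6 → F) := {a | a 1 = 0 ∧ a 3 ≠ 0 ∧ a 0 = 0 ∧ a 2 = 0 ∧ 4 * a 3 * a 5 = a 4 ^ 2}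
def D3 : Set (Fin 6 → F) := {a | a 1 = 0 ∧ a 0 = 0 ∧ a 3 = 0 ∧ a 2 = 0 ∧ a 4 = 0 ∧ a 5 ≠ 0}
def I1 : Set (Fin 6 → F) :=
  {a | a 1 = 0 ∧ a 0 ≠ 0 ∧ a 3 ≠ 0 ∧ 4 * a 0 * a 3 * a 5 = a 0 * a 4 ^ 2 + a 3 * a 2 ^ 2 ∧
    ¬ IsSquare (- (a 0 * a 3))}
def I2 : Set (Fin 6 → F) :=
  {a | a 1 = 0 ∧ a 0 = 0 ∧ a 3 ≠ 0 ∧ a 2 = 0 ∧ ¬ IsSquare (a 4 ^ 2 - 4 * a 3 * a 5)}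
def I3 : Set (Fin 6 → F) :=
  {a | a 1 = 0 ∧ a 3 = 0 ∧ a 0 ≠ 0 ∧ a 4 = 0 ∧ ¬ IsSquare (a 2 ^ 2 - 4 * a 0 * a 5)}
def Z1 : Set (Fin 6 → F) :=
  {a | a 1 = 0 ∧ a 0 ≠ 0 ∧ a 3 ≠ 0 ∧ 4 * a 0 * a 3 * a 5 = a 0 * a 4 ^ 2 + a 3 * a 2 ^ 2}
def Z2 : Set (Fin 6 → F) := {a | a 1 = 0 ∧ a 0 = 0 ∧ a 3 ≠ 0 ∧ a 2 = 0}
def Z3 : Set (Fin 6 → F) := {a | a 1 = 0 ∧ a 3 = 0 ∧ a 0 ≠ 0 ∧ a 4 = 0}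
def Z4 : Set (Fin 6 → F) := {a | a 1 = 0 ∧ a 0 = 0 ∧ a 3 = 0}
def ZZ : Set (Fin 6 → F) := {a | a 1 = 0 ∧ disc a = 0}
def NS : Set (Fin 6 → F) := {a | a ≠ 0 ∧ a 1 = 0 ∧ IsNonsingular a}
def DD : Set (Fin 6 → F) := {a | a ≠ 0 ∧ a 1 = 0 ∧ IsDoubleLine a}
def RR : Set (Fin 6 → F) := {a | a ≠ 0 ∧ a 1 = 0 ∧ IsRealPair a}
def II : Set (Fin 6 → F) := {a | a ≠ 0 ∧ a 1 = 0 ∧ IsImagPair a}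
def VV : Set (Fin 6 → F) := {a | a 1 = 0}
end char

section cards
variable [Fintype F]

lemma card_VV : (VV F).ncard = Fintype.card F ^ 5 := by
  rw [ncard_param (fun s : F × F × F × F × F => ![s.1, 0, s.2.1, s.2.2.1, s.2.2.2.1, s.2.2.2.2])
    (fun a => (a 0, a 2, a 3, a 4, a 5))
    (Set.univ ×ˢ (Set.univ ×ˢ (Set.univ ×ˢ (Set.univ ×ˢ Set.univ)))) (VV F)]
  · simp only [Set.ncard_prod, card_univ']; ring
  · rintro ⟨s0, s2, s3, s4, s5⟩ _
    exact ⟨by simp [VV], by simp⟩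
  · intro a ha
    simp only [VV, Set.mem_ofPred_eq] at ha
    exact ⟨by simp, by apply vec_ext <;> simp [ha]⟩

lemma card_Z4 : (Z4 F).ncard = Fintype.card F ^ 3 := by
  rw [ncard_param (fun s : F × F × F => ![0, 0, s.1, 0, s.2.1, s.2.2])
    (fun a => (a 2, a 4, a 5))
    (Set.univ ×ˢ (Set.univ ×ˢ Set.univ)) (Z4 F)]
  · simp only [Set.ncard_prod, card_univ']; ring
  · rintro ⟨s0, s2, s3⟩ _
    exact ⟨by simp [Z4], by simp⟩
  · intro a ha
    simp only [Z4, Set.mem_ofPred_eq] at ha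
    exact ⟨by simp, by apply vec_ext <;> simp [ha]⟩

lemma card_Z2 : (Z2 F).ncard = (Fintype.card F - 1) * Fintype.card F ^ 2 := by
  rw [ncard_param (fun s : F × F × F => ![0, 0, 0, s.1, s.2.1, s.2.2])
    (fun a => (a 3, a 4, a 5))
    (Uset F ×ˢ (Set.univ ×ˢ Set.univ)) (Z2 F)]
  · simp only [Set.ncard_prod, card_univ', card_U]; ring
  · rintro ⟨s0, s2, s3⟩ hs
    simp [Uset] at hs
    exact ⟨by simp [Z2, hs], by simp⟩
  · intro a ha
    simp only [Z2, Set.mem_ofPred_eq] at ha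
    exact ⟨by simp [Uset, ha], by apply vec_ext <;> simp [ha]⟩

lemma card_Z3 : (Z3 F).ncard = (Fintype.card F - 1) * Fintype.card F ^ 2 := by
  rw [ncard_param (fun s : F × F × F => ![s.1, 0, s.2.1, 0, 0, s.2.2])
    (fun a => (a 0, a 2, a 5))
    (Uset F ×ˢ (Set.univ ×ˢ Set.univ)) (Z3 F)]
  · simp only [Set.ncard_prod, card_univ', card_U]; ring
  · rintro ⟨s0, s2, s3⟩ hs
    simp [Uset] at hs
    exact ⟨by simp [Z3, hs], by simp⟩
  · intro a ha
    simp only [Z3, Set.mem_ofPred_eq] at ha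
    exact ⟨by simp [Uset, ha], by apply vec_ext <;> simp [ha]⟩

lemma card_D3 : (D3 F).ncard = (Fintype.card F - 1) := by
  rw [ncard_param (fun s : F => ![0, 0, 0, 0, 0, s]) (fun a => a 5) (Uset F) (D3 F)]
  · exact card_U
  · intro s hs
    simp [Uset] at hs
    exact ⟨by simp [D3, hs], by simp⟩
  · intro a ha
    simp only [D3, Set.mem_ofPred_eq] at ha
    exact ⟨by simp [Uset, ha], by apply vec_ext <;> simp [ha]⟩

lemma four_ne (h2 : (2 : F) ≠ 0) : (4 : F) ≠ 0 := by
  have : (4 : F) = 2 * 2 := by norm_num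
  rw [this]; exact mul_ne_zero h2 h2

lemma card_D1 (h2 : (2 : F) ≠ 0) : (D1 F).ncard = (Fintype.card F - 1) * Fintype.card F := by
  have h4 := four_ne h2
  rw [ncard_param (fun s : F × F => ![s.1, 0, s.2, 0, 0, s.2 ^ 2 / (4 * s.1)])
    (fun a => (a 0, a 2)) (Uset F ×ˢ Set.univ) (D1 F)]
  · simp only [Set.ncard_prod, card_univ', card_U]
  · rintro ⟨s0, s2⟩ hs
    simp [Uset] at hs
    refine ⟨?_, by simp⟩
    simp [D1, hs]
    field_simp
  · intro a ha
    simp only [D1, Set.mem_ofPred_eq] at ha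
    obtain ⟨h1, h0, h3, h5, h6⟩ := ha
    refine ⟨by simp [Uset, h0], by apply vec_ext <;> simp [*]; field_simp; linear_combination -h6⟩

lemma card_D2 (h2 : (2 : F) ≠ 0) : (D2 F).ncard = (Fintype.card F - 1) * Fintype.card F := by
  have h4 := four_ne h2
  rw [ncard_param (fun s : F × F => ![0, 0, 0, s.1, s.2, s.2 ^ 2 / (4 * s.1)])
    (fun a => (a 3, a 4)) (Uset F ×ˢ Set.univ) (D2 F)]
  · simp only [Set.ncard_prod, card_univ', card_U]
  · rintro ⟨s0, s2⟩ hs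
    simp [Uset] at hs
    refine ⟨?_, by simp⟩
    simp [D2, hs]
    field_simp
  · intro a ha
    simp only [D2, Set.mem_ofPred_eq] at ha
    obtain ⟨h1, h0, h3, h5, h6⟩ := ha
    refine ⟨by simp [Uset, h0], by apply vec_ext <;> simp [*]; field_simp; linear_combination -h6⟩

lemma card_I2 (h2 : (2 : F) ≠ 0) :
    (I2 F).ncard = (Fintype.card F - 1) * (Fintype.card F * (Nset F).ncard) := by
  have h4 := four_ne h2
  rw [ncard_param (fun s : F × F × F => ![0, 0, 0, s.1, s.2.1, (s.2.1 ^ 2 - s.2.2) / (4 * s.1)])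
    (fun a => (a 3, a 4, a 4 ^ 2 - 4 * a 3 * a 5)) (Uset F ×ˢ (Set.univ ×ˢ Nset F)) (I2 F)]
  · simp only [Set.ncard_prod, card_univ', card_U]
  · rintro ⟨s0, s2, s3⟩ hs
    simp [Uset, Nset] at hs
    have e : s2 ^ 2 - 4 * s0 * ((s2 ^ 2 - s3) / (4 * s0)) = s3 := by
      have := hs.1
      field_simp; ring
    exact ⟨by simp [I2, hs, e], by simp [e]⟩
  · intro a ha
    simp only [I2, Set.mem_ofPred_eq] at ha
    obtain ⟨h1, h0, h3, h5, h6⟩ := ha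
    refine ⟨by simp [Uset, Nset, h3, h6], by apply vec_ext <;> simp [*]⟩

lemma card_I3 (h2 : (2 : F) ≠ 0) :
    (I3 F).ncard = (Fintype.card F - 1) * (Fintype.card F * (Nset F).ncard) := by
  have h4 := four_ne h2
  rw [ncard_param (fun s : F × F × F => ![s.1, 0, s.2.1, 0, 0, (s.2.1 ^ 2 - s.2.2) / (4 * s.1)])
    (fun a => (a 0, a 2, a 2 ^ 2 - 4 * a 0 * a 5)) (Uset F ×ˢ (Set.univ ×ˢ Nset F)) (I3 F)]
  · simp only [Set.ncard_prod, card_univ', card_U]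
  · rintro ⟨s0, s2, s3⟩ hs
    simp [Uset, Nset] at hs
    have e : s2 ^ 2 - 4 * s0 * ((s2 ^ 2 - s3) / (4 * s0)) = s3 := by
      have := hs.1
      field_simp; ring
    exact ⟨by simp [I3, hs, e], by simp [e]⟩
  · intro a ha
    simp only [I3, Set.mem_ofPred_eq] at ha
    obtain ⟨h1, h0, h3, h5, h6⟩ := ha
    refine ⟨by simp [Uset, Nset, h3, h6], by apply vec_ext <;> simp [*]⟩

lemma card_Z1 (h2 : (2 : F) ≠ 0) :
    (Z1 F).ncard = (Fintype.card F - 1) ^ 2 * Fintype.card F ^ 2 := by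
  have h4 := four_ne h2
  rw [ncard_param (fun s : F × F × F × F => ![s.1, 0, s.2.2.1, s.2.1, s.2.2.2,
      (s.1 * s.2.2.2 ^ 2 + s.2.1 * s.2.2.1 ^ 2) / (4 * s.1 * s.2.1)])
    (fun a => (a 0, a 3, a 2, a 4)) (Uset F ×ˢ (Uset F ×ˢ (Set.univ ×ˢ Set.univ))) (Z1 F)]
  · simp only [Set.ncard_prod, card_univ', card_U]; ring
  · rintro ⟨s0, s3, s2, s4⟩ hs
    simp [Uset] at hs
    obtain ⟨h0, h3⟩ := hs
    refine ⟨?_, by simp⟩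
    simp [Z1, h0, h3]
    field_simp
  · intro a ha
    simp only [Z1, Set.mem_ofPred_eq] at ha
    obtain ⟨h1, h0, h3, h6⟩ := ha
    refine ⟨by simp [Uset, h0, h3], by apply vec_ext <;> simp [*]; field_simp; linear_combination -h6⟩

lemma card_I1 (h2 : (2 : F) ≠ 0) :
    (I1 F).ncard = (Fintype.card F - 1) * (Nset F).ncard * Fintype.card F ^ 2 := by
  have h4 := four_ne h2
  rw [ncard_param (fun s : F × F × F × F => ![s.1, 0, s.2.2.1, - s.2.1 / s.1, s.2.2.2,
      (s.1 * s.2.2.2 ^ 2 + (- s.2.1 / s.1) * s.2.2.1 ^ 2) / (4 * s.1 * (- s.2.1 / s.1))])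
    (fun a => (a 0, - (a 0 * a 3), a 2, a 4))
    (Uset F ×ˢ (Nset F ×ˢ (Set.univ ×ˢ Set.univ))) (I1 F)]
  · simp only [Set.ncard_prod, card_univ', card_U]; ring
  · rintro ⟨s0, n, s2, s4⟩ hs
    simp [Uset, Nset] at hs
    obtain ⟨h0, h3⟩ := hs
    have hn : n ≠ 0 := by rintro rfl; exact h3 (IsSquare.zero)
    have e : -(s0 * (-n / s0)) = n := by field_simp
    refine ⟨?_, by simp [e]⟩
    simp [I1, h0, hn, e, h3]
    field_simp
  · intro a ha
    simp only [I1, Set.mem_ofPred_eq] at ha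
    obtain ⟨h1, h0, h3, h6, h7⟩ := ha
    have e : a 0 * a 3 / a 0 = a 3 := by field_simp
    refine ⟨by simp [Uset, Nset, h0, h7], by apply vec_ext <;> simp [*]; field_simp; linear_combination -h6⟩

end cards

lemma disc_mulLin (l m : Fin 3 → F) : disc (mulLin l m) = 0 := by
  simp [disc, mulLin]; ring

lemma DD_eq (h2 : (2 : F) ≠ 0) : DD F = D1 F ∪ (D2 F ∪ D3 F) := by
  ext a
  simp only [DD, D1, D2, D3, Set.mem_ofPred_eq, Set.mem_union]
  constructor
  · rintro ⟨ha, h1, c, l, hc, hl, rfl⟩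
    simp [mulLin, hc] at h1 ⊢
    have h01 : l 0 * l 1 = 0 := by
      have : 2 * (l 0 * l 1) = 0 := by linear_combination h1
      exact (mul_eq_zero.1 this).resolve_left h2
    rcases mul_eq_zero.1 h01 with h | h
    · by_cases h' : l 1 = 0
      · have h'' : l 2 ≠ 0 := by
          intro h''; apply hl; funext i; fin_cases i <;> simp [h, h', h'']
        simp [h, h', h'']
      · simp [h, h']; ring
    · by_cases h' : l 0 = 0
      · have h'' : l 2 ≠ 0 := by
          intro h''; apply hl; funext i; fin_cases i <;> simp [h, h', h'']
        simp [h, h', h'']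
      · simp [h, h']; ring
  · rintro (⟨h1, h0, h3, h4, h5⟩ | ⟨h1, h0, h3, h4, h5⟩ | ⟨h1, h0, h3, h4, h5, h6⟩)
    · refine ⟨fun h => h0 (by simp [h]), h1, a 0, ![1, 0, a 2 / (2 * a 0)], h0,
        fun h => by simpa using congrFun h 0, ?_⟩
      apply vec_ext <;> simp [mulLin, h1, h3, h4]
      · field_simp; ring
      · field_simp; linear_combination h5
    · refine ⟨fun h => h0 (by simp [h]), h1, a 3, ![0, 1, a 4 / (2 * a 3)], h0,
        fun h => by simpa using congrFun h 1, ?_⟩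
      apply vec_ext <;> simp [mulLin, h1, h3, h4]
      · field_simp; ring
      · field_simp; linear_combination h5
    · refine ⟨fun h => h6 (by simp [h]), h1, a 5, ![0, 0, 1], h6,
        fun h => by simpa using congrFun h 2, ?_⟩
      apply vec_ext <;> simp [mulLin, h1, h3, h4, h0, h5]

lemma II_eq (h2 : (2 : F) ≠ 0) : II F = I1 F ∪ (I2 F ∪ I3 F) := by
  ext a
  simp only [II, I1, I2, I3, Set.mem_ofPred_eq, Set.mem_union]
  constructor
  · rintro ⟨ha, h1, hd, hn⟩
    by_contra hcon
    push Not at hcon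
    obtain ⟨c1, c2, c3⟩ := hcon
    apply hn
    have hd' : 4 * a 0 * a 3 * a 5 = a 0 * a 4 ^ 2 + a 3 * a 2 ^ 2 := by
      simp only [disc, h1] at hd
      linear_combination hd
    by_cases h0 : a 0 = 0
    · by_cases h3 : a 3 = 0
      · refine ⟨![0, 0, 1], ![a 2, a 4, a 5], ?_⟩
        apply vec_ext <;> simp [mulLin, h0, h1, h3]
      · have ha2 : a 2 = 0 := by
          simp [h0, h3] at hd'
          exact hd'
        obtain ⟨s, hs⟩ := c2 h1 h0 h3 ha2
        refine ⟨![0, a 3, (a 4 + s) / 2], ![0, 1, (a 4 - s) / (2 * a 3)], ?_⟩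
        apply vec_ext <;> simp [mulLin, h0, h1, ha2]
        · field_simp; ring
        · field_simp; linear_combination -hs
    · by_cases h3 : a 3 = 0
      · have ha4 : a 4 = 0 := by
          simp [h0, h3] at hd'
          exact hd'
        obtain ⟨s, hs⟩ := c3 h1 h3 h0 ha4
        refine ⟨![a 0, 0, (a 2 + s) / 2], ![1, 0, (a 2 - s) / (2 * a 0)], ?_⟩
        apply vec_ext <;> simp [mulLin, h3, h1, ha4]
        · field_simp; ring
        · field_simp; linear_combination -hs
      · obtain ⟨s, hs⟩ := c1 h1 h0 h3 hd'
        refine ⟨![1, - s / a 0, a 2 / (2 * a 0) - s * a 4 / (2 * a 3 * a 0)],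
          ![a 0, s, a 2 / 2 + s * a 4 / (2 * a 3)], ?_⟩
        apply vec_ext <;> simp [mulLin, h1]
        · field_simp; ring
        · field_simp; ring
        · field_simp; linear_combination -hs
        · field_simp; linear_combination (-2) * a 4 * hs
        · field_simp; linear_combination a 3 * hd' - a 4 ^ 2 * hs
  · rintro (⟨h1, h0, h3, h4, h5⟩ | ⟨h1, h0, h3, h4, h5⟩ | ⟨h1, h0, h3, h4, h5⟩)
    · refine ⟨fun h => h0 (by simp [h]), h1, ?_, ?_⟩
      · simp only [disc, h1]; linear_combination h4
      · rintro ⟨l, m, rfl⟩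
        apply h5
        simp [mulLin] at h1 ⊢
        exact ⟨l 0 * m 1, by linear_combination (-l 0 * m 1) * h1⟩
    · refine ⟨fun h => h3 (by simp [h]), h1, ?_, ?_⟩
      · simp only [disc, h1, h0, h4]; ring
      · rintro ⟨l, m, rfl⟩
        apply h5
        simp [mulLin]
        exact ⟨l 1 * m 2 - l 2 * m 1, by ring⟩
    · refine ⟨fun h => h3 (by simp [h]), h1, ?_, ?_⟩
      · simp only [disc, h1, h0, h4]; ring
      · rintro ⟨l, m, rfl⟩
        apply h5
        simp [mulLin]
        exact ⟨l 0 * m 2 - l 2 * m 0, by ring⟩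

lemma ZZ_eq (h2 : (2 : F) ≠ 0) : ZZ F = Z1 F ∪ (Z2 F ∪ (Z3 F ∪ Z4 F)) := by
  ext a
  simp only [ZZ, Z1, Z2, Z3, Z4, Set.mem_ofPred_eq, Set.mem_union, disc]
  constructor
  · rintro ⟨h1, hd⟩
    by_cases h0 : a 0 = 0 <;> by_cases h3 : a 3 = 0
    · simp [h0, h1, h3]
    · simp [h0, h1, h3] at hd ⊢; exact hd
    · simp [h0, h1, h3] at hd ⊢; exact hd
    · simp [h0, h1, h3] at hd ⊢; linear_combination hd
  · rintro (⟨h1, h0, h3, h4⟩ | ⟨h1, h0, h3, h4⟩ | ⟨h1, h0, h3, h4⟩ | ⟨h1, h0, h3⟩)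
    · exact ⟨h1, by rw [h1]; linear_combination h4⟩
    · exact ⟨h1, by rw [h1, h0, h4]; ring⟩
    · exact ⟨h1, by rw [h1, h0, h4]; ring⟩
    · exact ⟨h1, by rw [h1, h0, h3]; ring⟩

lemma prop_of_minors {l m : Fin 3 → F} (h01 : l 0 * m 1 = l 1 * m 0)
    (h02 : l 0 * m 2 = l 2 * m 0) (h12 : l 1 * m 2 = l 2 * m 1) :
    (∃ t : F, m = t • l) ∨ (∃ t : F, l = t • m) := by
  by_cases hl : l = 0
  · right; exact ⟨0, by simp [hl]⟩
  · left
    obtain ⟨i, hi⟩ := Function.ne_iff.1 hl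
    refine ⟨m i / l i, ?_⟩
    funext j
    simp only [Pi.zero_apply, ne_eq] at hi
    simp only [Pi.smul_apply, smul_eq_mul]
    fin_cases i <;> fin_cases j <;> simp at hi ⊢ <;> field_simp <;> grind

lemma not_double_real {a : Fin 6 → F} (hd : IsDoubleLine a) (hr : IsRealPair a) : False := by
  obtain ⟨c, l, hc, hl, rfl⟩ := hd
  obtain ⟨b, d, h1, h2, h⟩ := hr
  have e0 := congrFun h 0
  have e1 := congrFun h 1
  have e2 := congrFun h 2
  have e3 := congrFun h 3
  have e4 := congrFun h 4
  have e5 := congrFun h 5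
  simp [mulLin] at e0 e1 e2 e3 e4 e5
  have h01 : b 0 * d 1 = b 1 * d 0 := by
    apply sub_eq_zero.1; apply pow_eq_zero_iff (two_ne_zero) |>.1
    grind
  have h02 : b 0 * d 2 = b 2 * d 0 := by
    apply sub_eq_zero.1; apply pow_eq_zero_iff (two_ne_zero) |>.1
    grind
  have h12 : b 1 * d 2 = b 2 * d 1 := by
    apply sub_eq_zero.1; apply pow_eq_zero_iff (two_ne_zero) |>.1
    grind
  rcases prop_of_minors h01 h02 h12 with h | h
  · exact h1 h
  · exact h2 h

lemma mulLin_comm (l m : Fin 3 → F) : mulLin l m = mulLin m l := by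
  funext i
  fin_cases i <;> simp [mulLin] <;> ring

lemma double_prod {a : Fin 6 → F} (hd : IsDoubleLine a) : ∃ l m, a = mulLin l m := by
  obtain ⟨c, l, hc, hl, rfl⟩ := hd
  exact ⟨c • l, l, smul_mulLin _ _ _⟩

lemma double_of_smul {l : Fin 3 → F} {t : F} (h : mulLin l (t • l) ≠ 0) :
    IsDoubleLine (mulLin l (t • l)) := by
  rw [mulLin_comm, ← smul_mulLin] at h ⊢
  refine ⟨t, l, ?_, ?_, rfl⟩
  · rintro rfl; simp at h
  · rintro rfl
    apply h
    funext i
    fin_cases i <;> simp [mulLin]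

lemma ZZ_split : ZZ F = {0} ∪ (DD F ∪ (RR F ∪ II F)) := by
  ext a
  simp only [ZZ, DD, RR, II, Set.mem_ofPred_eq, Set.mem_union, Set.mem_singleton_iff]
  constructor
  · rintro ⟨h1, hd⟩
    by_cases h0 : a = 0
    · left; exact h0
    right
    by_cases hp : ∃ l m : Fin 3 → F, a = mulLin l m
    · obtain ⟨l, m, rfl⟩ := hp
      by_cases hr : IsRealPair (mulLin l m)
      · right; left; exact ⟨h0, h1, hr⟩
      · left; refine ⟨h0, h1, ?_⟩
        by_cases h : ∃ t : F, m = t • l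
        · obtain ⟨t, rfl⟩ := h; exact double_of_smul h0
        by_cases h' : ∃ t : F, l = t • m
        · obtain ⟨t, rfl⟩ := h'
          rw [mulLin_comm] at h0 ⊢
          exact double_of_smul h0
        exact absurd ⟨l, m, h, h', rfl⟩ hr
    · right; right; exact ⟨h0, h1, hd, hp⟩
  · rintro (rfl | ⟨h0, h1, h⟩ | ⟨h0, h1, h⟩ | ⟨h0, h1, h⟩)
    · simp [disc]
    · obtain ⟨l, m, rfl⟩ := double_prod h
      exact ⟨h1, disc_mulLin _ _⟩
    · obtain ⟨l, m, -, -, rfl⟩ := h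
      exact ⟨h1, disc_mulLin _ _⟩
    · exact ⟨h1, h.1⟩

lemma VV_split : VV F = ZZ F ∪ NS F := by
  ext a
  simp only [VV, ZZ, NS, IsNonsingular, Set.mem_ofPred_eq, Set.mem_union]
  constructor
  · intro h
    by_cases hd : disc a = 0
    · exact Or.inl ⟨h, hd⟩
    · refine Or.inr ⟨?_, h, hd⟩
      rintro rfl
      exact hd (by simp [disc])
  · rintro (h | h)
    · exact h.1
    · exact h.2.1

section final
variable [Fintype F]

lemma nc_union {A B : Set (Fin 6 → F)} (h : ∀ a, a ∈ A → a ∈ B → False) :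
    (A ∪ B).ncard = A.ncard + B.ncard :=
  Set.ncard_union_eq (Set.disjoint_left.2 h) (Set.toFinite _) (Set.toFinite _)

lemma nDD (h2 : (2 : F) ≠ 0) : (DD F).ncard = (D1 F).ncard + ((D2 F).ncard + (D3 F).ncard) := by
  rw [DD_eq h2, nc_union, nc_union]
  · rintro a h h'; exact h.2.1 h'.2.2.1
  · rintro a h (h' | h')
    · exact h.2.1 h'.2.2.1
    · exact h.2.1 h'.2.1

lemma nII (h2 : (2 : F) ≠ 0) : (II F).ncard = (I1 F).ncard + ((I2 F).ncard + (I3 F).ncard) := by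
  rw [II_eq h2, nc_union, nc_union]
  · rintro a h h'; exact h.2.2.1 h'.2.1
  · rintro a h (h' | h')
    · exact h.2.1 h'.2.1
    · exact h.2.2.1 h'.2.1

lemma nZZ (h2 : (2 : F) ≠ 0) :
    (ZZ F).ncard = (Z1 F).ncard + ((Z2 F).ncard + ((Z3 F).ncard + (Z4 F).ncard)) := by
  rw [ZZ_eq h2, nc_union, nc_union, nc_union]
  · rintro a h h'; exact h.2.2.1 h'.2.1
  · rintro a h (h' | h')
    · exact h.2.2.1 h'.2.1
    · exact h.2.2.1 h'.2.2
  · rintro a h (h' | h' | h')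
    · exact h.2.1 h'.2.1
    · exact h.2.2.1 h'.2.1
    · exact h.2.1 h'.2.1

lemma nZZ' : (ZZ F).ncard = 1 + ((DD F).ncard + ((RR F).ncard + (II F).ncard)) := by
  rw [ZZ_split, nc_union, nc_union, nc_union, Set.ncard_singleton]
  · rintro a ⟨-, -, l, m, -, -, h⟩ h'; exact h'.2.2.2 ⟨l, m, h⟩
  · rintro a h (h' | h')
    · exact not_double_real h.2.2 h'.2.2
    · exact h'.2.2.2 (double_prod h.2.2)
  · rintro a h (h' | h' | h') <;> exact h'.1 h

lemma nVV : (VV F).ncard = (ZZ F).ncard + (NS F).ncard := by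
  rw [VV_split, nc_union]
  rintro a h h'; exact h'.2.2 h.2
end final

end Helpers

/-- conic counts of a rank-2 exterior squab, `q` odd. -/
theorem squab_rank_two_exterior_conic_counts (F : Type) [Field F] [Fintype F] (q : ℕ)
    (hq : Fintype.card F = q) (hodd : Odd q) (y : Fin 6 → F) (hy : y ≠ 0)
    (hrk : (M y).rank = 2) (hext : IsExterior y) :
    numConics (squab y) IsDoubleLine = 2 * q + 1 ∧
    numConics (squab y) IsRealPair = (q ^ 3 + 3 * q ^ 2) / 2 ∧
    numConics (squab y) IsImagPair = (q ^ 3 + q ^ 2) / 2 - q ∧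
    numConics (squab y) IsNonsingular = q ^ 4 - q ^ 2 := by
  have hc : ringChar F ≠ 2 := by
    intro h
    rw [FiniteField.even_card_iff_char_two, hq] at h
    rcases hodd with ⟨k, hk⟩
    omega
  have h2 : (2 : F) ≠ 0 := Ring.two_ne_zero hc
  obtain ⟨G, H, p, hp, hHG, hGH, hB⟩ := exists_frame h2 y hrk hext
  have tD := transport y IsDoubleLine hp hHG hGH hB (fun t ht a h => smul_double ht h)
    (fun G H h a ha => act_double h ha)
  have tR := transport y IsRealPair hp hHG hGH hB (fun t ht a h => smul_real ht h)
    (fun G H h a ha => act_real h ha)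
  have tI := transport y IsImagPair hp hHG hGH hB (fun t ht a h => smul_imag ht h)
    (fun G H h a ha => act_imag h2 h ha)
  have tN := transport y IsNonsingular hp hHG hGH hB (fun t ht a h => smul_nonsing ht h)
    (fun G H h a ha => act_nonsing h2 h ha)
  change _ = (DD F).ncard at tD
  change _ = (RR F).ncard at tR
  change _ = (II F).ncard at tI
  change _ = (NS F).ncard at tN
  have kN := card_N hc
  have kD := nDD h2
  have kI := nII h2
  have kZ := nZZ h2
  have kZ' := nZZ' (F := F)
  have kV := nVV (F := F)
  rw [card_D1 h2, card_D2 h2, card_D3, ← tD] at kD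
  rw [card_I1 h2, card_I2 h2, card_I3 h2, ← tI] at kI
  rw [card_Z1 h2, card_Z2, card_Z3, card_Z4] at kZ
  rw [← tD, ← tR, ← tI] at kZ'
  rw [card_VV, ← tN] at kV
  have hcard : 1 < Fintype.card F := Fintype.one_lt_card
  rw [hq] at *
  obtain ⟨k, rfl⟩ := hodd
  have hk : 0 < k := by omega
  simp only [Nat.add_sub_cancel] at *
  have hN : (Nset F).ncard = k := by omega
  rw [hN] at kI
  rw [kZ] at kZ' kV
  generalize numConics (squab y) IsDoubleLine = d at *
  generalize numConics (squab y) IsRealPair = r at *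
  generalize numConics (squab y) IsImagPair = i at *
  generalize numConics (squab y) IsNonsingular = n at *
  have hk2 : 0 < 2 * k := by omega
  have hd : d = 2 * (2 * k + 1) + 1 := by
    apply Nat.eq_of_mul_eq_mul_left hk2
    rw [kD]; ring
  have hi : i = k * (2 * k + 1) ^ 2 + 2 * k * (2 * k + 1) := by
    apply Nat.eq_of_mul_eq_mul_left hk2
    rw [kI]; ring
  have hr : r = (k + 2) * (2 * k + 1) ^ 2 := by
    apply Nat.eq_of_mul_eq_mul_left hk2
    subst hd hi
    zify at kZ' ⊢
    linear_combination -kZ'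
  have hn : n = (2 * k + 1) ^ 2 * (2 * k) * (2 * k + 2) := by
    apply Nat.eq_of_mul_eq_mul_left hk2
    zify at kV ⊢
    linear_combination -kV
  refine ⟨hd, ?_, ?_, ?_⟩
  · rw [hr]; symm
    apply Nat.div_eq_of_eq_mul_right (by norm_num)
    ring
  · have : ((2 * k + 1) ^ 3 + (2 * k + 1) ^ 2) / 2 = (k + 1) * (2 * k + 1) ^ 2 := by
      apply Nat.div_eq_of_eq_mul_right (by norm_num)
      ring
    rw [this, hi]; symm
    apply Nat.sub_eq_of_eq_add
    ring
  · rw [hn]; symm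
    apply Nat.sub_eq_of_eq_add
    ring
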